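/- arXiv:1508.06865 — 2 statements merged into one kernel-verified Lean document; each statement's English description precedes it below -/
import Mathlib

section
/- There exists a set S and a scenario f : ℝ → S such that for every T₃-anonymous predictor P, the set {x ∈ ℝ : P(f)(x) = f(x)} is countable. -/
namespace T3Aux

open Filter Topology

/-- The rescaled smooth step: `0` for `y ≤ r`, `1` for `y ≥ r + 1/m`. -/
noncomputable def phi (r : ℚ) (m : ℚ≥0) (y : ℝ) : ℝ :=
  Real.smoothTransition ((m : ℝ) * (y - (r : ℝ)))

lemma phi_contDiff (r : ℚ) (m : ℚ≥0) : ContDiff ℝ (⊤ : ℕ∞) (phi r m) := by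
  unfold phi
  exact Real.smoothTransition.contDiff.comp (by fun_prop)

lemma phi_mono (r : ℚ) (m : ℚ≥0) : Monotone (phi r m) := by
  intro a b hab
  apply Real.smoothTransition.monotone
  gcongr

lemma phi_nonneg (r : ℚ) (m : ℚ≥0) (y : ℝ) : 0 ≤ phi r m y := Real.smoothTransition.nonneg _

lemma phi_le_one (r : ℚ) (m : ℚ≥0) (y : ℝ) : phi r m y ≤ 1 := Real.smoothTransition.le_one _

lemma phi_zero (r : ℚ) (m : ℚ≥0) (y : ℝ) (h : y ≤ r) : phi r m y = 0 := by
  apply Real.smoothTransition.zero_of_nonpos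
  exact mul_nonpos_of_nonneg_of_nonpos (by positivity) (by linarith)

lemma norm_iter_const (k : ℕ) (c y : ℝ) : ‖iteratedFDeriv ℝ k (fun _ : ℝ => c) y‖ ≤ |c| := by
  rcases Nat.eq_zero_or_pos k with rfl | hk
  · simp
  · rw [iteratedFDeriv_const_of_ne hk.ne']
    simp

/-- A smooth function constant on both ends has bounded derivatives. -/
lemma bounded_iter (φ : ℝ → ℝ) (hφ : ContDiff ℝ (⊤ : ℕ∞) φ) (a b c d : ℝ)
    (ha : ∀ y < a, φ y = c) (hb : ∀ y > b, φ y = d) (k : ℕ) :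
    ∃ M : ℝ, ∀ y, ‖iteratedFDeriv ℝ k φ y‖ ≤ M := by
  have hc : Continuous (iteratedFDeriv ℝ k φ) :=
    hφ.continuous_iteratedFDeriv (by exact_mod_cast le_top)
  obtain ⟨M, hM⟩ := (isCompact_Icc (a := a) (b := b)).exists_bound_of_continuousOn hc.continuousOn
  refine ⟨max M (max |c| |d|), fun y => ?_⟩
  by_cases h1 : y < a
  · have : φ =ᶠ[𝓝 y] fun _ => c := by
      filter_upwards [Iio_mem_nhds h1] with z hz using ha z hz
    rw [(this.iteratedFDeriv (𝕜 := ℝ) k).eq_of_nhds]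
    exact (norm_iter_const k c y).trans (by simp)
  by_cases h2 : b < y
  · have : φ =ᶠ[𝓝 y] fun _ => d := by
      filter_upwards [Ioi_mem_nhds h2] with z hz using hb z hz
    rw [(this.iteratedFDeriv (𝕜 := ℝ) k).eq_of_nhds]
    exact (norm_iter_const k d y).trans (by simp)
  · exact (hM y ⟨not_lt.1 h1, not_lt.1 h2⟩).trans (by simp)

lemma surj_of_bounded (h : ℝ → ℝ) (hc : Continuous h) (a b : ℝ)
    (ha : ∀ y, y + a ≤ h y) (hb : ∀ y, h y ≤ y + b) : Function.Surjective h := by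
  apply hc.surjective
  · exact tendsto_atTop_mono ha (tendsto_atTop_add_const_right _ _ tendsto_id)
  · exact tendsto_atBot_mono hb (tendsto_atBot_add_const_right _ _ tendsto_id)

/-- Countable index type. -/
abbrev Ix : Type := Σ N : ℕ, ℚ × (Fin N → ℚ≥0 × ℚ × ℚ≥0)

/-- The countable family of smooth increasing bijections. -/
noncomputable def g (i : Ix) (y : ℝ) : ℝ :=
  y + (i.2.1 : ℝ) + ∑ j, ((i.2.2 j).1 : ℝ) * phi (i.2.2 j).2.1 (i.2.2 j).2.2 y

lemma g_bij (i : Ix) : Function.Bijective (g i) := by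
  constructor
  · apply StrictMono.injective
    intro a b hab
    unfold g
    have : ∑ j, ((i.2.2 j).1 : ℝ) * phi (i.2.2 j).2.1 (i.2.2 j).2.2 a ≤
      ∑ j, ((i.2.2 j).1 : ℝ) * phi (i.2.2 j).2.1 (i.2.2 j).2.2 b := by
      apply Finset.sum_le_sum
      intro j _
      exact mul_le_mul_of_nonneg_left (phi_mono _ _ hab.le) (by positivity)
    linarith
  · apply surj_of_bounded _ _ (i.2.1 : ℝ) ((i.2.1 : ℝ) + ∑ j, ((i.2.2 j).1 : ℝ))
    · intro y
      unfold g
      have : 0 ≤ ∑ j, ((i.2.2 j).1 : ℝ) * phi (i.2.2 j).2.1 (i.2.2 j).2.2 y := by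
        apply Finset.sum_nonneg
        intro j _
        exact mul_nonneg (by positivity) (phi_nonneg _ _ _)
      linarith
    · intro y
      unfold g
      have : ∑ j, ((i.2.2 j).1 : ℝ) * phi (i.2.2 j).2.1 (i.2.2 j).2.2 y ≤
          ∑ j, ((i.2.2 j).1 : ℝ) := by
        apply Finset.sum_le_sum
        intro j _
        exact mul_le_of_le_one_right (by positivity) (phi_le_one _ _ _)
      linarith
    · unfold g
      have := fun r m => (phi_contDiff r m).continuous
      fun_prop

noncomputable def e (i : Ix) : Equiv.Perm ℝ := Equiv.ofBijective (g i) (g_bij i)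

/-- The scenario: each real is sent to its orbit. -/
noncomputable def scen (y : ℝ) : Set ℝ := Set.range fun w : FreeGroup Ix => FreeGroup.lift e w y

instance : Countable (FreeGroup Ix) :=
  inferInstanceAs (Countable (Quot _))

lemma scen_countable (y : ℝ) : (scen y).Countable := Set.countable_range _

lemma mem_scen (y : ℝ) : y ∈ scen y := ⟨1, by simp⟩

lemma scen_g (i : Ix) (y : ℝ) : scen (g i y) = scen y := by
  have he : ∀ z, e i z = g i z := fun z => rfl
  ext z
  constructor
  · rintro ⟨w, rfl⟩
    exact ⟨w * FreeGroup.of i, by simp [he]⟩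
  · rintro ⟨w, rfl⟩
    exact ⟨w * (FreeGroup.of i)⁻¹, by simp [← he]⟩

lemma exists_seq (d : ℝ) (ε : ℕ → ℝ) (hε : ∀ n, 0 < ε n) :
    ∃ s : ℕ → ℚ, StrictMono s ∧ (∀ n, (s n : ℝ) < d) ∧ (∀ n, d - s n < ε n) ∧
      Tendsto (fun n => (s n : ℝ)) atTop (𝓝 d) := by
  let E : ℕ → ℝ := fun n => ∏ k ∈ Finset.range (n + 1), min (ε k) (1 / 2)
  have hm : ∀ k, 0 < min (ε k) (1 / 2) := fun k => lt_min (hε k) (by norm_num)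
  have hm2 : ∀ k, min (ε k) (1 / 2) ≤ 1 / 2 := fun k => min_le_right _ _
  have hE : ∀ n, 0 < E n := fun n => Finset.prod_pos fun k _ => hm k
  have hs : ∀ n, E (n + 1) = E n * min (ε (n + 1)) (1 / 2) := fun n => Finset.prod_range_succ _ _
  have hE1 : ∀ n, E (n + 1) < E n := by
    intro n
    rw [hs]
    nlinarith [hE n, hm2 (n + 1)]
  have hEp : ∀ n, E n ≤ (1 / 2) ^ n := by
    intro n
    induction n with
    | zero =>
      have := hm2 0
      simp only [E, zero_add, Finset.prod_range_one, pow_zero]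
      linarith
    | succ n ih =>
      rw [hs, pow_succ]
      exact mul_le_mul ih (hm2 _) (hm _).le (by positivity)
  have hEε : ∀ n, E n ≤ ε n := by
    intro n
    have h1 : E n = (∏ k ∈ Finset.range n, min (ε k) (1 / 2)) * min (ε n) (1 / 2) :=
      Finset.prod_range_succ _ _
    have h2 : ∏ k ∈ Finset.range n, min (ε k) (1 / 2) ≤ 1 :=
      Finset.prod_le_one (fun k _ => (hm k).le) (fun k _ => (hm2 k).trans (by norm_num))
    rw [h1]
    exact (mul_le_of_le_one_left (hm n).le h2).trans (min_le_left _ _)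
  have hex : ∀ n, ∃ q : ℚ, d - E n < q ∧ (q : ℝ) < d - E (n + 1) := fun n =>
    exists_rat_btwn (by linarith [hE1 n])
  choose s hs1 hs2 using hex
  refine ⟨s, strictMono_nat_of_lt_succ fun n => ?_, fun n => ?_, fun n => ?_, ?_⟩
  · have := (hs2 n).trans (hs1 (n + 1))
    exact_mod_cast this
  · linarith [hs2 n, hE (n + 1)]
  · linarith [hs1 n, hEε n]
  · refine tendsto_of_tendsto_of_tendsto_of_le_of_le
      (g := fun n : ℕ => d - (1 / 2 : ℝ) ^ n) (h := fun _ => d) ?_ tendsto_const_nhds ?_ ?_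
    · have := tendsto_pow_atTop_nhds_zero_of_lt_one (r := (1 / 2 : ℝ)) (by norm_num) (by norm_num)
      simpa using this.const_sub d
    · intro n
      have := hs1 n
      have := hEp n
      show d - (1 / 2 : ℝ) ^ n ≤ s n
      linarith
    · intro n
      have := hs2 n
      have := hE (n + 1)
      show (s n : ℝ) ≤ d
      linarith

lemma exists_steps (x : ℝ) : ∃ (r : ℕ → ℚ) (m : ℕ → ℚ≥0),
    (∀ y < x, ∃ N, ∀ n ≥ N, phi (r n) (m n) y = 0) ∧
    (∀ n, phi (r n) (m n) x = 1) ∧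
    (∀ n, ∀ y ≥ x, phi (r n) (m n) y = 1) := by
  have h1 : ∀ n : ℕ, ∃ q : ℚ, x - 1 / ((n : ℝ) + 1) < q ∧ (q : ℝ) < x := fun n =>
    exists_rat_btwn (by
      have : (0 : ℝ) < 1 / ((n : ℝ) + 1) := by positivity
      linarith)
  choose r hr1 hr2 using h1
  have h2 : ∀ n, ∃ k : ℕ, 1 / (x - r n) < k := fun n => exists_nat_gt _
  choose m hm using h2
  have h3 : ∀ n, ∀ y ≥ x, phi (r n) (m n : ℚ≥0) y = 1 := by
    intro n y hy
    apply Real.smoothTransition.one_of_one_le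
    have hpos : 0 < x - r n := by linarith [hr2 n]
    have h4 := hm n
    rw [div_lt_iff₀ hpos] at h4
    have h5 : (m n : ℝ) * (x - r n) ≤ (m n : ℝ) * (y - r n) := by gcongr
    push_cast
    linarith
  refine ⟨r, fun n => (m n : ℚ≥0), ?_, fun n => h3 n x le_rfl, h3⟩
  intro y hy
  obtain ⟨N, hN⟩ := exists_nat_one_div_lt (sub_pos.2 hy)
  refine ⟨N, fun n hn => phi_zero _ _ _ ?_⟩
  have h6 : 1 / ((n : ℝ) + 1) ≤ 1 / ((N : ℝ) + 1) := by
    have : (N : ℝ) ≤ n := by exact_mod_cast hn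
    gcongr
  linarith [hr1 n]

lemma exists_delta (r : ℚ) (m : ℚ≥0) (x : ℝ) (h1 : ∀ y ≥ x, phi r m y = 1) (n : ℕ) :
    ∃ δ : ℝ, 0 < δ ∧ ∀ k ≤ n, ∀ y, δ * ‖iteratedFDeriv ℝ k (phi r m) y‖ ≤ (1 / 2) ^ n := by
  choose M hM using bounded_iter (phi r m) (phi_contDiff r m) r x 0 1
    (fun y hy => phi_zero _ _ _ hy.le) (fun y hy => h1 y (le_of_lt hy))
  have hM0 : ∀ k, 0 ≤ M k := fun k => (norm_nonneg _).trans (hM k 0)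
  let C := 1 + ∑ k ∈ Finset.range (n + 1), M k
  have hC : 0 < C := by
    have : 0 ≤ ∑ k ∈ Finset.range (n + 1), M k := Finset.sum_nonneg fun k _ => hM0 k
    simp only [C]
    linarith
  refine ⟨(1 / 2) ^ n / C, by positivity, fun k hk y => ?_⟩
  have hk2 : M k ≤ C := by
    have := Finset.single_le_sum (f := M) (fun k _ => hM0 k)
      (Finset.mem_range.2 (Nat.lt_succ_of_le hk))
    simp only [C]
    linarith
  have hle := (hM k y).trans hk2
  rw [div_mul_eq_mul_div, div_le_iff₀ hC]
  gcongr

lemma key (x d : ℝ) : ∃ t : ℝ → ℝ, ContDiff ℝ (⊤ : ℕ∞) t ∧ StrictMono t ∧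
    Function.Bijective t ∧ t x = x + d ∧ ∀ y < x, ∃ i, t y = g i y := by
  obtain ⟨r, m, hz, h1, h1'⟩ := exists_steps x
  choose δ hδ hδb using fun n => exists_delta (r n) (m n) x (h1' n) n
  obtain ⟨s, hsm, hsd, hse, hst⟩ := exists_seq d δ hδ
  let q : ℕ → ℝ := fun n => (s (n + 1) : ℝ) - s n
  have hq0 : ∀ n, 0 ≤ q n := by
    intro n
    have : (s n : ℝ) < s (n + 1) := by exact_mod_cast hsm (Nat.lt_succ_self n)
    simp only [q]
    linarith
  have hqδ : ∀ n, q n ≤ δ n := by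
    intro n
    have := hse n
    have := hsd (n + 1)
    simp only [q]
    linarith
  have hqs : HasSum q (d - s 0) := by
    rw [hasSum_iff_tendsto_nat_of_nonneg hq0]
    have : ∀ n, ∑ i ∈ Finset.range n, q i = (s n : ℝ) - s 0 := fun n =>
      Finset.sum_range_sub (fun n => (s n : ℝ)) n
    simp only [this]
    exact hst.sub_const _
  have hsum : ∀ y, Summable fun n => q n * phi (r n) (m n) y := fun y =>
    Summable.of_nonneg_of_le (fun n => mul_nonneg (hq0 n) (phi_nonneg _ _ _))
      (fun n => mul_le_of_le_one_right (hq0 n) (phi_le_one _ _ _)) hqs.summable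
  let t : ℝ → ℝ := fun y => y + s 0 + ∑' n, q n * phi (r n) (m n) y
  have hsmooth : ContDiff ℝ (⊤ : ℕ∞) t := by
    have : ContDiff ℝ (⊤ : ℕ∞) fun y => ∑' n, q n * phi (r n) (m n) y := by
      refine contDiff_tsum_of_eventually (v := fun _ n => (1 / 2 : ℝ) ^ n)
        (fun n => contDiff_const.mul (phi_contDiff _ _)) (fun k _ => summable_geometric_two) ?_
      intro k _
      rw [Nat.cofinite_eq_atTop]
      filter_upwards [eventually_ge_atTop k] with n hn y
      have hc : iteratedFDeriv ℝ k (fun y => q n * phi (r n) (m n) y) y =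
          q n • iteratedFDeriv ℝ k (phi (r n) (m n)) y := by
        have := iteratedFDeriv_const_smul_apply (𝕜 := ℝ) (i := k) (a := q n) (x := y)
          (f := phi (r n) (m n))
          (((phi_contDiff (r n) (m n)).of_le (by exact_mod_cast le_top)).contDiffAt)
        exact this
      rw [hc, norm_smul, Real.norm_of_nonneg (hq0 n)]
      exact (mul_le_mul_of_nonneg_right (hqδ n) (norm_nonneg _)).trans (hδb n k hn y)
    exact (contDiff_id.add contDiff_const).add this
  have hmono : StrictMono t := by
    intro a b hab
    have : ∑' n, q n * phi (r n) (m n) a ≤ ∑' n, q n * phi (r n) (m n) b :=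
      (hsum a).tsum_le_tsum
        (fun n => mul_le_mul_of_nonneg_left (phi_mono _ _ hab.le) (hq0 n)) (hsum b)
    simp only [t]
    linarith
  refine ⟨t, hsmooth, hmono, ⟨hmono.injective, ?_⟩, ?_, ?_⟩
  · apply surj_of_bounded t hsmooth.continuous (s 0 : ℝ) d
    · intro y
      have : 0 ≤ ∑' n, q n * phi (r n) (m n) y :=
        tsum_nonneg fun n => mul_nonneg (hq0 n) (phi_nonneg _ _ _)
      simp only [t]
      linarith
    · intro y
      have : ∑' n, q n * phi (r n) (m n) y ≤ ∑' n, q n :=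
        (hsum y).tsum_le_tsum (fun n => mul_le_of_le_one_right (hq0 n) (phi_le_one _ _ _))
          hqs.summable
      rw [hqs.tsum_eq] at this
      simp only [t]
      linarith
  · simp only [t, h1, mul_one, hqs.tsum_eq]
    ring
  · intro y hy
    obtain ⟨N, hN⟩ := hz y hy
    refine ⟨⟨N, s 0, fun j => ((s (j + 1) - s j).toNNRat, r j, m j)⟩, ?_⟩
    have hfin : ∑' n, q n * phi (r n) (m n) y =
        ∑ n ∈ Finset.range N, q n * phi (r n) (m n) y := by
      apply tsum_eq_sum
      intro n hn
      rw [hN n (by simpa using hn), mul_zero]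
    simp only [t, g, hfin]
    rw [Finset.sum_range]
    congr 1
    apply Finset.sum_congr rfl
    intro j _
    congr 1
    have h0 : (0 : ℚ) ≤ s (j + 1) - s j := sub_nonneg.2 (hsm (Nat.lt_succ_self _)).le
    have h2 : (((s (j + 1) - s j).toNNRat : ℚ≥0) : ℚ) = s (j + 1) - s j := Rat.coe_toNNRat _ h0
    have h3 : (((s (j + 1) - s j).toNNRat : ℚ≥0) : ℝ) =
        ((((s (j + 1) - s j).toNNRat : ℚ≥0) : ℚ) : ℝ) := by norm_cast
    rw [h3, h2]
    simp only [q]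
    push_cast
    rfl

end T3Aux

theorem T3_anonymous_predictors_fail :
    ∃ (S : Type) (f : ℝ → S),
      ∀ P : (ℝ → S) → (ℝ → S),
        (∀ (g₁ g₂ : ℝ → S) (x : ℝ), (∀ y < x, g₁ y = g₂ y) → P g₁ x = P g₂ x) →
        (∀ (g : ℝ → S) (t : ℝ → ℝ), ContDiff ℝ (⊤ : ℕ∞) t → StrictMono t →
          Function.Bijective t → P (g ∘ t) = P g ∘ t) →
        {x : ℝ | P f x = f x}.Countable := by
  refine ⟨Set ℝ, T3Aux.scen, fun P hP hA => ?_⟩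
  have hconst : ∀ x x', P T3Aux.scen x = P T3Aux.scen x' := by
    intro x x'
    obtain ⟨t, ht1, ht2, ht3, htx, hti⟩ := T3Aux.key x (x' - x)
    have h1 : P (T3Aux.scen ∘ t) x = P T3Aux.scen x := by
      apply hP
      intro y hy
      obtain ⟨i, hi⟩ := hti y hy
      simp only [Function.comp, hi, T3Aux.scen_g]
    rw [← h1, hA _ t ht1 ht2 ht3, Function.comp, htx]
    congr 1
    ring
  rcases Set.eq_empty_or_nonempty {x : ℝ | P T3Aux.scen x = T3Aux.scen x} with h | ⟨z, hz⟩
  · rw [h]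
    exact Set.countable_empty
  · refine (T3Aux.scen_countable z).mono fun x hx => ?_
    have h2 : T3Aux.scen x = T3Aux.scen z := by
      rw [← show P T3Aux.scen x = T3Aux.scen x from hx, hconst x z]
      exact hz
    rw [← h2]
    exact T3Aux.mem_scen x
end

section
/- For any two real numbers w and z, there exists an infinitely differentiable strictly increasing bijection t : ℝ → ℝ with t(w) = z such that for every x < w, t(x) is related to x by some member of the countable family F of rational smooth transition maps (i.e., there exist rationals p₁ < p₂ and q₁ < q₂ with x ∈ [p₁,p₂] and t(x) = s_{(p₁,q₁)(p₂,q₂)}(x)). -/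
open Real Set Filter Topology
set_option maxHeartbeats 1000000

theorem aux_glue_lt {x y : ℝ} (hx : 0 ≤ x) (hxy : x < y) : expNegInvGlue x < expNegInvGlue y := by
  rcases hx.eq_or_lt with rfl | hx
  · rw [expNegInvGlue.zero]; exact expNegInvGlue.pos_of_pos hxy
  · have hy := hx.trans hxy
    simp only [expNegInvGlue, not_le.2 hx, not_le.2 hy, if_false]
    apply Real.exp_lt_exp.2
    have := (inv_lt_inv₀ hy hx).2 hxy
    linarith

theorem aux_S_lt {x y : ℝ} (hx : 0 ≤ x) (hx1 : x < 1) (hxy : x < y) :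
    smoothTransition x < smoothTransition y := by
  unfold smoothTransition
  rw [div_lt_div_iff₀ (smoothTransition.pos_denom x) (smoothTransition.pos_denom y)]
  have h1 := aux_glue_lt hx hxy
  have h2 : expNegInvGlue (1 - y) ≤ expNegInvGlue (1 - x) := expNegInvGlue.monotone (by linarith)
  have h3 : 0 < expNegInvGlue (1 - x) := expNegInvGlue.pos_of_pos (by linarith)
  have h4 := expNegInvGlue.nonneg x
  nlinarith [mul_le_mul_of_nonneg_left h2 h4, mul_lt_mul_of_pos_right h1 h3]

theorem aux_bound (k : ℕ) : ∃ C : ℝ, 0 ≤ C ∧ ∀ x, ‖iteratedDeriv k smoothTransition x‖ ≤ C := by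
  have hc : Continuous (iteratedDeriv k smoothTransition) :=
    ContDiff.continuous_iteratedDeriv (n := ((k : ℕ∞) : WithTop ℕ∞)) k
      smoothTransition.contDiff le_rfl
  obtain ⟨C, hC⟩ := (isCompact_Icc (a := (0:ℝ)) (b := 1)).exists_bound_of_continuousOn
    hc.continuousOn
  refine ⟨max C 1, by positivity, fun x => ?_⟩
  by_cases h0 : x < 0
  · have : smoothTransition =ᶠ[𝓝 x] fun _ => (0:ℝ) := by
      filter_upwards [Iio_mem_nhds h0] with y hy
      exact smoothTransition.zero_of_nonpos (le_of_lt hy)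
    rw [this.iteratedDeriv_eq, iteratedDeriv_const]
    simp
  by_cases h1 : 1 < x
  · have : smoothTransition =ᶠ[𝓝 x] fun _ => (1:ℝ) := by
      filter_upwards [Ioi_mem_nhds h1] with y hy
      exact smoothTransition.one_of_one_le (le_of_lt hy)
    rw [this.iteratedDeriv_eq, iteratedDeriv_const]
    split_ifs <;> simp
  exact (hC x ⟨not_lt.1 h0, not_lt.1 h1⟩).trans (le_max_left _ _)

noncomputable def auxL (x : ℝ) : ℝ := if x ≤ 0 then ⌊x⌋ + smoothTransition (Int.fract x) else 0

theorem auxL_of_nonneg {x : ℝ} (hx : 0 ≤ x) : auxL x = 0 := by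
  unfold auxL
  rcases hx.eq_or_lt with rfl | hx
  · simp [smoothTransition.zero]
  · simp [not_le.2 hx]

theorem auxL_strict {x y : ℝ} (hx : x < 0) (hxy : x < y) : auxL x < auxL y := by
  have hS : smoothTransition (Int.fract x) < 1 :=
    smoothTransition.lt_one_of_lt_one (Int.fract_lt_one x)
  rcases le_total 0 y with hy | hy
  · rw [auxL_of_nonneg hy]
    simp only [auxL, hx.le, if_true]
    have : ⌊x⌋ < 0 := Int.floor_lt.2 (by simpa using hx)
    have : ((⌊x⌋ : ℤ) : ℝ) ≤ -1 := by exact_mod_cast Int.le_sub_one_of_lt this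
    linarith
  · simp only [auxL, hx.le, hy, if_true]
    rcases (Int.floor_mono hxy.le).eq_or_lt with h | h
    · rw [h]
      have : Int.fract x < Int.fract y := by
        simp only [Int.fract, h]; linarith
      have := aux_S_lt (Int.fract_nonneg x) (Int.fract_lt_one x) this
      linarith
    · have : ((⌊x⌋ : ℤ) : ℝ) + 1 ≤ ⌊y⌋ := by exact_mod_cast h
      have := smoothTransition.nonneg (Int.fract y)
      linarith

theorem auxL_mono : Monotone auxL := by
  intro x y hxy
  rcases lt_or_ge x 0 with h | h
  · rcases hxy.eq_or_lt with rfl | h'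
    · exact le_rfl
    · exact (auxL_strict h h').le
  · rw [auxL_of_nonneg h, auxL_of_nonneg (h.trans hxy)]

theorem aux_step (n : ℤ) {x : ℝ} (h1 : n - 1 < x) (h2 : x < n + 1) :
    ⌊x⌋ + smoothTransition (Int.fract x)
      = n - 1 + smoothTransition (x - (n - 1)) + smoothTransition (x - n) := by
  rcases lt_or_ge x n with h | h
  · have : ⌊x⌋ = n - 1 := Int.floor_eq_iff.2 ⟨by push_cast; linarith, by push_cast; linarith⟩
    rw [Int.fract, this, smoothTransition.zero_of_nonpos (x := x - n) (by linarith)]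
    push_cast; ring
  · have : ⌊x⌋ = n := Int.floor_eq_iff.2 ⟨h, h2⟩
    rw [Int.fract, this, smoothTransition.one_of_one_le (x := x - (n - 1)) (by linarith)]
    ring

theorem auxL_contDiff : ContDiff ℝ (⊤ : ℕ∞) auxL := by
  have hS : ContDiff ℝ (⊤ : ℕ∞) smoothTransition := smoothTransition.contDiff
  rw [contDiff_iff_contDiffAt]
  intro x
  rcases lt_or_ge x 0 with h | h
  · have hc : ContDiff ℝ (⊤ : ℕ∞) (fun y : ℝ => ((⌊x⌋ : ℤ) : ℝ) - 1
        + smoothTransition (y - (((⌊x⌋ : ℤ) : ℝ) - 1)) + smoothTransition (y - ((⌊x⌋ : ℤ) : ℝ))) := by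
      fun_prop
    refine hc.contDiffAt.congr_of_eventuallyEq ?_
    filter_upwards [Iio_mem_nhds h, Iio_mem_nhds (Int.lt_floor_add_one x),
      Ioi_mem_nhds (show ((⌊x⌋ : ℤ) : ℝ) - 1 < x by linarith [Int.floor_le x])] with y h1 h2 h3
    simp only [auxL, le_of_lt (show y < 0 from h1), if_true]
    exact aux_step _ h3 h2
  · have hc : ContDiff ℝ (⊤ : ℕ∞) (fun y : ℝ => -1 + smoothTransition (y + 1)) := by fun_prop
    refine hc.contDiffAt.congr_of_eventuallyEq ?_
    filter_upwards [Ioi_mem_nhds (show -1 < x by linarith)] with y h1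
    rcases lt_or_ge y 0 with h0 | h0
    · have := aux_step 0 (x := y) (by simpa using h1) (by push_cast; linarith)
      simp only [auxL, h0.le, if_true]
      rw [this, smoothTransition.zero_of_nonpos (x := y - ((0:ℤ):ℝ)) (by push_cast; linarith)]
      simp
    · rw [auxL_of_nonneg h0, smoothTransition.one_of_one_le (by linarith)]; simp

theorem auxL_le {x : ℝ} (hx : x ≤ 0) : auxL x ≤ x + 1 := by
  simp only [auxL, hx, if_true]
  linarith [Int.floor_le x, smoothTransition.le_one (Int.fract x)]

noncomputable def auxR (x : ℝ) : ℝ := x * expNegInvGlue x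

theorem auxR_of_nonpos {x : ℝ} (hx : x ≤ 0) : auxR x = 0 := by
  simp [auxR, expNegInvGlue.zero_of_nonpos hx]

theorem auxR_strict {x y : ℝ} (hx : 0 ≤ x) (hxy : x < y) : auxR x < auxR y := by
  unfold auxR
  exact mul_lt_mul'' hxy (aux_glue_lt hx hxy) hx (expNegInvGlue.nonneg x)

theorem auxR_mono : Monotone auxR := by
  intro x y hxy
  rcases le_or_gt 0 x with h | h
  · exact mul_le_mul hxy (expNegInvGlue.monotone hxy) (expNegInvGlue.nonneg x) (h.trans hxy)
  · rw [auxR_of_nonpos h.le]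
    rcases le_total 0 y with h' | h'
    · exact mul_nonneg h' (expNegInvGlue.nonneg y)
    · rw [auxR_of_nonpos h']

theorem aux_seqp (w : ℝ) : ∃ p : ℕ → ℚ, ∀ n, w - (1/4)^n < p n ∧ (p n : ℝ) < w - (1/4)^n / 2 := by
  have : ∀ n : ℕ, ∃ q : ℚ, w - (1/4)^n < (q:ℝ) ∧ (q : ℝ) < w - (1/4)^n / 2 := fun n => by
    apply exists_rat_btwn
    have : (0:ℝ) < (1/4)^n := by positivity
    linarith
  exact ⟨fun n => (this n).choose, fun n => (this n).choose_spec⟩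

theorem aux_seqq (z : ℝ) : ∃ q : ℕ → ℚ, ∀ n, z - 1 / ((n+1).factorial : ℝ) < q n ∧
    (q n : ℝ) < z - 1 / ((n+2).factorial : ℝ) := by
  have : ∀ n : ℕ, ∃ q : ℚ, z - 1 / ((n+1).factorial : ℝ) < (q:ℝ) ∧
      (q : ℝ) < z - 1 / ((n+2).factorial : ℝ) := fun n => by
    apply exists_rat_btwn
    have : (((n+1).factorial : ℕ) : ℝ) < ((n+2).factorial : ℕ) := by
      exact_mod_cast (Nat.factorial_lt (Nat.succ_pos n)).2 (by omega)
    have := one_div_lt_one_div_of_lt (by positivity) this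
    linarith
  exact ⟨fun n => (this n).choose, fun n => (this n).choose_spec⟩

theorem smooth_time_change_exists (h s : ℝ → ℝ)
    (hh : ∀ x, h x = if x ≤ 0 then 0 else Real.exp (-1 / x))
    (hs : ∀ x, s x = h x / (h x + h (1 - x))) :
    ∀ w z : ℝ, ∃ t : ℝ → ℝ,
      ContDiff ℝ (⊤ : ℕ∞) t ∧ StrictMono t ∧ Function.Bijective t ∧ t w = z ∧
      ∀ x < w, ∃ p₁ p₂ q₁ q₂ : ℚ,
        (p₁ : ℝ) < p₂ ∧ (q₁ : ℝ) < q₂ ∧ x ∈ Set.Icc (p₁ : ℝ) (p₂ : ℝ) ∧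
        t x = ((q₂ : ℝ) - q₁) * s ((x - p₁) / ((p₂ : ℝ) - p₁)) + q₁ := by
  intro w z
  have hhe : h = expNegInvGlue := by
    funext x
    rw [hh, expNegInvGlue, neg_div, one_div]
  have hse : s = smoothTransition := by
    funext x
    rw [hs, hhe, smoothTransition]
  subst hse
  clear hs hh hhe h
  obtain ⟨p, hp⟩ := aux_seqp w
  obtain ⟨q, hq⟩ := aux_seqq z
  have hpw : ∀ n, (p n : ℝ) < w := fun n => by
    have : (0:ℝ) < (1/4)^n := by positivity
    linarith [(hp n).2]
  have hqz : ∀ n, (q n : ℝ) < z := fun n => by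
    have : (0:ℝ) < 1 / ((n+2).factorial : ℝ) := by positivity
    linarith [(hq n).2]
  have he : ∀ n, (1/4 : ℝ)^n / 4 < (p (n+1) : ℝ) - p n := fun n => by
    have h1 := (hp n).2
    have h2 := (hp (n+1)).1
    rw [pow_succ] at h2
    linarith
  have he0 : ∀ n, 0 < (p (n+1) : ℝ) - p n := fun n => lt_trans (by positivity) (he n)
  have hd0 : ∀ n, 0 < (q (n+1) : ℝ) - q n := fun n => by linarith [(hq n).2, (hq (n+1)).1]
  have hd : ∀ n, (q (n+1) : ℝ) - q n ≤ 1 / (n.factorial : ℝ) := fun n => by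
    have : (n.factorial : ℝ) ≤ ((n+1).factorial : ℕ) := by
      exact_mod_cast Nat.factorial_le (by omega)
    have := one_div_le_one_div_of_le (by positivity) this
    linarith [(hq n).1, hqz (n+1)]
  have hpm : StrictMono (fun n => (p n : ℝ)) := strictMono_nat_of_lt_succ fun n => by
    linarith [he0 n]
  have hptend : Tendsto (fun n => (p n : ℝ)) atTop (𝓝 w) := by
    have h4 : Tendsto (fun n : ℕ => w - (1/4 : ℝ)^n) atTop (𝓝 w) := by
      simpa using (tendsto_pow_atTop_nhds_zero_of_lt_one (r := (1/4:ℝ))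
        (by norm_num) (by norm_num)).const_sub w
    exact tendsto_of_tendsto_of_tendsto_of_le_of_le h4 tendsto_const_nhds
      (fun n => (hp n).1.le) (fun n => (hpw n).le)
  have hqtend : Tendsto (fun n => (q n : ℝ)) atTop (𝓝 z) := by
    have h4 : Tendsto (fun n : ℕ => z - 1 / ((n+1).factorial : ℝ)) atTop (𝓝 z) := by
      have h5 : Tendsto (fun n : ℕ => 1 / (n.factorial : ℝ)) atTop (𝓝 0) := by
        simpa using (Real.summable_pow_div_factorial 1).tendsto_atTop_zero
      simpa using ((tendsto_add_atTop_iff_nat 1).2 h5).const_sub z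
    exact tendsto_of_tendsto_of_tendsto_of_le_of_le h4 tendsto_const_nhds
      (fun n => (hq n).1.le) (fun n => (hqz n).le)
  -- the terms of the series
  set f : ℕ → ℝ → ℝ := fun n x =>
    ((q (n+1) : ℝ) - q n) * smoothTransition ((x - p n) / ((p (n+1) : ℝ) - p n)) with hf
  have hS : ContDiff ℝ (⊤ : ℕ∞) smoothTransition := smoothTransition.contDiff
  have hf0 : ∀ (n : ℕ) (x : ℝ), x ≤ p n → f n x = 0 := fun n x hx => by
    simp only [hf]
    rw [smoothTransition.zero_of_nonpos, mul_zero]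
    exact div_nonpos_of_nonpos_of_nonneg (by linarith) (he0 n).le
  have hf1 : ∀ n x, (p (n+1) : ℝ) ≤ x → f n x = (q (n+1) : ℝ) - q n := fun n x hx => by
    simp only [hf]
    rw [smoothTransition.one_of_one_le, mul_one]
    rw [le_div_iff₀ (he0 n)]
    linarith
  have hfm : ∀ n, Monotone (f n) := fun n x y hxy => by
    apply mul_le_mul_of_nonneg_left _ (hd0 n).le
    apply smoothTransition.monotone
    exact div_le_div_of_nonneg_right (by linarith) (he0 n).le
  have hfn : ∀ n x, 0 ≤ f n x := fun n x => mul_nonneg (hd0 n).le (smoothTransition.nonneg _)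
  have hfle : ∀ n x, f n x ≤ (q (n+1) : ℝ) - q n := fun n x =>
    mul_le_of_le_one_right (hd0 n).le (smoothTransition.le_one _)
  have hfs : ∀ x, Summable (fun n => f n x) := fun x =>
    Summable.of_nonneg_of_le (fun n => hfn n x) (fun n => (hfle n x).trans (hd n))
      (by simpa using Real.summable_pow_div_factorial 1)
  set T : ℝ → ℝ := fun x => ∑' n, f n x with hT
  have hTm : Monotone T := fun x y hxy =>
    (hfs x).tsum_le_tsum (fun n => hfm n hxy) (hfs y)
  have hTc : ContDiff ℝ (⊤ : ℕ∞) T := by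
    choose C hC0 hC using aux_bound
    refine contDiff_tsum (N := ⊤) (v := fun k n => C k * 4^k * ((4^k)^n / (n.factorial : ℝ)))
      (fun n => ?_) (fun k _ => (Real.summable_pow_div_factorial _).mul_left _) ?_
    · exact contDiff_const.mul (hS.comp ((contDiff_id.sub contDiff_const).div_const _))
    · intro k n x _
      rw [norm_iteratedFDeriv_eq_norm_iteratedDeriv]
      have e1 : f n = fun x => ((q (n+1) : ℝ) - q n) *
          (fun y => smoothTransition (((p (n+1) : ℝ) - p n)⁻¹ * y)) (x - p n) := by
        funext x; simp only [hf]; rw [div_eq_inv_mul]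
      rw [e1, iteratedDeriv_const_mul_field, iteratedDeriv_comp_sub_const k
          (fun y => smoothTransition (((p (n+1) : ℝ) - p n)⁻¹ * y)) (p n : ℝ),
        iteratedDeriv_comp_const_mul smoothTransition.contDiff]
      rw [norm_mul, norm_mul, norm_pow, norm_inv, Real.norm_of_nonneg (hd0 n).le,
        Real.norm_of_nonneg (he0 n).le]
      have b1 : ((p (n+1) : ℝ) - p n)⁻¹ ≤ 4 * 4^n := by
        rw [inv_le_comm₀ (he0 n) (by positivity)]
        refine le_trans (le_of_eq ?_) (he n).le
        rw [one_div, inv_pow, mul_inv]; ring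
      calc _ ≤ (1 / (n.factorial : ℝ)) * ((4 * 4^n)^k * C k) := by
            have := (inv_pos.2 (he0 n)).le
            gcongr
            · exact hd n
            · exact hC k _
        _ = _ := by
            rw [mul_pow, ← pow_mul, ← pow_mul, mul_comm n k]; ring
  have hT0 : ∀ x : ℝ, x ≤ p 0 → T x = 0 := fun x hx => by
    have : ∀ n, f n x = 0 := fun n => hf0 n x (hx.trans (hpm.monotone (Nat.zero_le n)))
    simp [hT, this]
  have hT1 : ∀ (n : ℕ) (x : ℝ), (p n : ℝ) ≤ x → x ≤ p (n+1) → T x = q n - q 0 + f n x := fun n x h1 h2 => by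
    have e : T x = ∑ i ∈ Finset.range (n+1), f i x := by
      apply tsum_eq_sum
      intro i hi
      apply hf0
      refine h2.trans (hpm.monotone ?_)
      simpa using hi
    rw [e, Finset.sum_range_succ, ← Finset.sum_range_sub (fun n => (q n : ℝ))]
    congr 1
    apply Finset.sum_congr rfl
    intro i hi
    apply hf1
    exact (hpm.monotone (Nat.succ_le_of_lt (Finset.mem_range.1 hi))).trans h1
  have hTw : ∀ x : ℝ, w ≤ x → T x = z - q 0 := fun x hx => by
    apply HasSum.tsum_eq
    rw [(hfs x).hasSum_iff_tendsto_nat]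
    have : ∀ n, ∑ i ∈ Finset.range n, f i x = (q n : ℝ) - q 0 := fun n => by
      rw [← Finset.sum_range_sub (fun n => (q n : ℝ))]
      exact Finset.sum_congr rfl fun i _ => hf1 i x ((hpw _).le.trans hx)
    simp only [this]
    exact hqtend.sub_const _
  -- locating a point
  have hloc : ∀ x : ℝ, (p 0 : ℝ) ≤ x → x < w → ∃ n, (p n : ℝ) ≤ x ∧ x < p (n+1) := fun x h0 h1 => by
    have hex : ∃ n, x < p n := (hptend.eventually (lt_mem_nhds h1)).exists
    classical
    have hsp := Nat.find_spec hex
    have hmin := fun m => Nat.find_min (m := m) hex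
    rcases hN : Nat.find hex with _ | N
    · rw [hN] at hsp; linarith
    · rw [hN] at hsp hmin
      exact ⟨N, not_lt.1 (hmin N (Nat.lt_succ_self N)), hsp⟩
  have hTs : ∀ x y : ℝ, (p 0 : ℝ) ≤ x → x < w → x < y → T x < T y := fun x y h0 h1 hxy => by
    obtain ⟨n, hn1, hn2⟩ := hloc x h0 h1
    refine Summable.tsum_lt_tsum (i := n) (fun m => hfm m hxy.le) ?_ (hfs x) (hfs y)
    apply mul_lt_mul_of_pos_left _ (hd0 n)
    apply aux_S_lt
    · exact div_nonneg (by linarith) (he0 n).le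
    · rw [div_lt_one (he0 n)]; linarith
    · exact div_lt_div_of_pos_right (by linarith) (he0 n)
  set t : ℝ → ℝ := fun x => q 0 + auxL (x - p 0) + T x + auxR (x - w) with ht
  have hRc : ContDiff ℝ (⊤ : ℕ∞) auxR := contDiff_id.mul expNegInvGlue.contDiff
  have htc : ContDiff ℝ (⊤ : ℕ∞) t :=
    ((contDiff_const.add (auxL_contDiff.comp (contDiff_id.sub contDiff_const))).add hTc).add
      (hRc.comp (contDiff_id.sub contDiff_const))
  have htm : StrictMono t := fun x y hxy => by
    have l1 : auxL (x - p 0) ≤ auxL (y - p 0) := auxL_mono (by linarith)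
    have l2 := hTm hxy.le
    have l3 : auxR (x - w) ≤ auxR (y - w) := auxR_mono (by linarith)
    simp only [ht]
    rcases lt_or_ge x (p 0) with c | c
    · have : auxL (x - p 0) < auxL (y - p 0) := auxL_strict (by linarith) (by linarith)
      linarith
    rcases lt_or_ge x w with c' | c'
    · have := hTs x y c c' hxy
      linarith
    · have : auxR (x - w) < auxR (y - w) := auxR_strict (by linarith) (by linarith)
      linarith
  refine ⟨t, htc, htm, ⟨htm.injective, htc.continuous.surjective ?_ ?_⟩, ?_, ?_⟩
  · have hc : 0 < expNegInvGlue 1 := expNegInvGlue.pos_of_pos one_pos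
    have h1 : Tendsto (fun x : ℝ => z + (x - w) * expNegInvGlue 1) atTop atTop :=
      tendsto_atTop_add_const_left _ _
        ((tendsto_atTop_add_const_right _ (-w) tendsto_id).atTop_mul_const hc)
    refine tendsto_atTop_mono' _ ?_ h1
    filter_upwards [eventually_ge_atTop (w + 1)] with x hx
    simp only [ht]
    rw [hTw x (by linarith), auxL_of_nonneg (by linarith [hpw 0]), auxR]
    have : expNegInvGlue 1 ≤ expNegInvGlue (x - w) := expNegInvGlue.monotone (by linarith)
    have := mul_le_mul_of_nonneg_left this (show 0 ≤ x - w by linarith)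
    linarith
  · have h1 : Tendsto (fun x : ℝ => x + ((q 0 : ℝ) - p 0 + 1)) atBot atBot :=
      tendsto_atBot_add_const_right _ _ tendsto_id
    refine tendsto_atBot_mono' _ ?_ h1
    filter_upwards [eventually_le_atBot (p 0 : ℝ)] with x hx
    simp only [ht]
    rw [hT0 x hx, auxR_of_nonpos (by linarith [hpw 0])]
    linarith [auxL_le (show x - p 0 ≤ 0 by linarith)]
  · simp only [ht]
    rw [hTw w le_rfl, auxL_of_nonneg (by linarith [hpw 0]), auxR_of_nonpos (by linarith)]
    ring
  · intro x hx
    rcases lt_or_ge x (p 0) with c | c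
    · refine ⟨p 0 + ⌊x - p 0⌋, p 0 + ⌊x - p 0⌋ + 1, q 0 + ⌊x - p 0⌋, q 0 + ⌊x - p 0⌋ + 1,
        ?_, ?_, ⟨?_, ?_⟩, ?_⟩
      · push_cast; linarith
      · push_cast; linarith
      · push_cast; linarith [Int.floor_le (x - p 0)]
      · push_cast; linarith [Int.lt_floor_add_one (x - p 0)]
      · simp only [ht]
        rw [hT0 x c.le, auxR_of_nonpos (by linarith)]
        simp only [auxL, show x - p 0 ≤ 0 by linarith, if_true, Int.fract]
        push_cast
        rw [add_sub_cancel_left, add_sub_cancel_left, div_one, sub_sub]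
        ring
    · obtain ⟨n, hn1, hn2⟩ := hloc x c hx
      refine ⟨p n, p (n+1), q n, q (n+1), by linarith [he0 n], by linarith [hd0 n],
        ⟨hn1, hn2.le⟩, ?_⟩
      simp only [ht]
      rw [hT1 n x hn1 hn2.le, auxR_of_nonpos (by linarith), auxL_of_nonneg (by linarith)]
      simp only [hf]
      ring
end
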